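/- arXiv:2503.03461 — 4 statements merged into one kernel-verified Lean document; each statement's English description precedes it below -/
import Mathlib

section
/- Let Γ be a non-elementary Fuchsian group, i.e., a discrete subgroup of PSL₂(ℝ) which does not contain a cyclic subgroup of finite index. Then the additive subgroup of ℝ generated by the length spectrum L(Γ) is dense in ℝ. -/
/-- `SL(2, ℝ)`. -/
abbrev SL2R := Matrix.SpecialLinearGroup (Fin 2) ℝ

/-- The subspace topology on `SL(2, ℝ)` induced from the space of matrices. -/
noncomputable instance : TopologicalSpace SL2R :=
  TopologicalSpace.induced (fun g => (g : Matrix (Fin 2) (Fin 2) ℝ)) inferInstance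

/-- `PSL(2, ℝ)`, the quotient of `SL(2, ℝ)` by its center `{±1}`. -/
abbrev PSL2R := SL2R ⧸ Subgroup.center SL2R

/-- The length spectrum of `Γ ≤ PSL(2, ℝ)`: the set of translation lengths
`2 log((|tr g| + √(tr(g)² − 4))/2)` of hyperbolic elements of `Γ` (those whose
representatives `g ∈ SL(2, ℝ)` satisfy `|tr g| > 2`). -/
def lengthSpectrum (Γ : Subgroup PSL2R) : Set ℝ :=
  {ℓ : ℝ | ∃ γ ∈ Γ, ∃ g : SL2R, QuotientGroup.mk g = γ ∧
    2 < |Matrix.trace (g : Matrix (Fin 2) (Fin 2) ℝ)| ∧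
    ℓ = 2 * Real.log ((|Matrix.trace (g : Matrix (Fin 2) (Fin 2) ℝ)| +
      Real.sqrt (Matrix.trace (g : Matrix (Fin 2) (Fin 2) ℝ) ^ 2 - 4)) / 2)}

section Helpers

open Filter Topology

/-- The translation length of a hyperbolic element of trace `t`. -/
noncomputable def translationLength (t : ℝ) : ℝ :=
  2 * Real.log ((|t| + Real.sqrt (t ^ 2 - 4)) / 2)

/-- A representation in `SL(2, ℝ)` is discrete if the identity is isolated in its image. -/
def IsDiscreteRep {G : Type*} [Group G] (ρ : G →* SL2R) : Prop :=
  ∀ᶠ M in 𝓝 (1 : Matrix (Fin 2) (Fin 2) ℝ), ∀ g, (ρ g : Matrix (Fin 2) (Fin 2) ℝ) = M → ρ g = 1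

/-- Up to finite index, the image of the representation is cyclic modulo `{±1}`. -/
def IsVirtuallyCyclicRep {G : Type*} [Group G] (ρ : G →* SL2R) : Prop :=
  ∃ H : Subgroup G, H.FiniteIndex ∧ ∃ h₀ : G, ∀ h ∈ H, ∃ k : ℤ,
    ρ h = ρ h₀ ^ k ∨ ρ h = -ρ h₀ ^ k

/-- The translation lengths of the representation are integral multiples of `α`. -/
def HasLengthsIn {G : Type*} [Group G] (ρ : G →* SL2R) (α : ℝ) : Prop :=
  ∀ g, 2 < |(ρ g : Matrix (Fin 2) (Fin 2) ℝ).trace| →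
    ∃ k : ℤ, translationLength (ρ g : Matrix (Fin 2) (Fin 2) ℝ).trace = k * α

/-- The conjugate of a representation. -/
def conjRep {G : Type*} [Group G] (P : SL2R) (ρ : G →* SL2R) : G →* SL2R :=
  (MulAut.conj P).toMonoidHom.comp ρ

lemma conjRep_apply {G : Type*} [Group G] (P : SL2R) (ρ : G →* SL2R) (g : G) :
    conjRep P ρ g = P * ρ g * P⁻¹ := rfl

lemma trace_conjRep {G : Type*} [Group G] (P : SL2R) (ρ : G →* SL2R) (g : G) :
    (conjRep P ρ g : Matrix (Fin 2) (Fin 2) ℝ).trace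
      = (ρ g : Matrix (Fin 2) (Fin 2) ℝ).trace := by
  rw [conjRep_apply, Matrix.SpecialLinearGroup.coe_mul, Matrix.trace_mul_comm,
    ← Matrix.SpecialLinearGroup.coe_mul, inv_mul_cancel_left]

lemma HasLengthsIn.conj {G : Type*} [Group G] {ρ : G →* SL2R} {α : ℝ}
    (h : HasLengthsIn ρ α) (P : SL2R) : HasLengthsIn (conjRep P ρ) α := by
  intro g hg
  rw [trace_conjRep] at hg ⊢
  exact h g hg

lemma IsDiscreteRep.conj {G : Type*} [Group G] {ρ : G →* SL2R}
    (h : IsDiscreteRep ρ) (P : SL2R) : IsDiscreteRep (conjRep P ρ) := by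
  have ht : Tendsto (fun M : Matrix (Fin 2) (Fin 2) ℝ =>
      (P⁻¹ : SL2R).1 * M * P.1) (𝓝 1) (𝓝 1) := by
    have hc : Continuous (fun M : Matrix (Fin 2) (Fin 2) ℝ => (P⁻¹ : SL2R).1 * M * P.1) := by
      fun_prop
    have := hc.tendsto 1
    rwa [mul_one, ← Matrix.SpecialLinearGroup.coe_mul, inv_mul_cancel,
      Matrix.SpecialLinearGroup.coe_one] at this
  filter_upwards [ht.eventually h] with M hM g hg
  have hconj : P⁻¹ * (P * ρ g * P⁻¹) * P = ρ g := by group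
  have := hM g (by
    rw [← hg, conjRep_apply, ← Matrix.SpecialLinearGroup.coe_mul,
      ← Matrix.SpecialLinearGroup.coe_mul, hconj])
  rw [conjRep_apply, this]
  group

lemma IsVirtuallyCyclicRep.of_conj {G : Type*} [Group G] {ρ : G →* SL2R} {P : SL2R}
    (h : IsVirtuallyCyclicRep (conjRep P ρ)) : IsVirtuallyCyclicRep ρ := by
  obtain ⟨H, hH, h₀, hh⟩ := h
  refine ⟨H, hH, h₀, fun h hm => ?_⟩
  obtain ⟨k, hk⟩ := hh h hm
  refine ⟨k, ?_⟩
  rw [conjRep_apply, conjRep_apply, conj_zpow] at hk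
  rcases hk with hk | hk
  · left
    simpa using hk
  · right
    have : P * ρ h * P⁻¹ = P * (-ρ h₀ ^ k) * P⁻¹ := by rw [hk]; simp
    exact mul_left_cancel (mul_right_cancel this)

lemma IsDiscreteRep.exists_eq_one {G : Type*} [Group G] {ρ : G →* SL2R}
    (h : IsDiscreteRep ρ) {g : ℕ → G} {m : ℕ → Matrix (Fin 2) (Fin 2) ℝ}
    (hm : ∀ n, (ρ (g n)).1 = m n) (hlim : Tendsto m atTop (𝓝 1)) : ∃ n, m n = 1 := by
  obtain ⟨n, hn⟩ := (hlim.eventually h).exists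
  exact ⟨n, by rw [← hm, hn (g n) (hm n), Matrix.SpecialLinearGroup.coe_one]⟩

/-- A discrete representation with values in `±E`, for a one-parameter group `E`, is cyclic
modulo `{±1}`. -/
lemma IsDiscreteRep.isVirtuallyCyclicRep {G : Type*} [Group G] {ρ : G →* SL2R}
    (hd : IsDiscreteRep ρ) (E : Multiplicative ℝ →* SL2R)
    (hcont : Continuous fun t : ℝ => (E (.ofAdd t)).1)
    (hinj : ∀ᶠ t : ℝ in 𝓝 0, E (.ofAdd t) = 1 → t = 0)
    (H : Subgroup G) (hH : H.FiniteIndex)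
    (hE : ∀ h ∈ H, ∃ t : ℝ, ρ h = E (.ofAdd t) ∨ ρ h = -E (.ofAdd t)) :
    IsVirtuallyCyclicRep ρ := by
  let A : AddSubgroup ℝ :=
    { carrier := {t | ∃ h ∈ H, ρ h = E (.ofAdd t) ∨ ρ h = -E (.ofAdd t)}
      zero_mem' := ⟨1, H.one_mem, by simp⟩
      add_mem' := by
        rintro s t ⟨g, hg, hs⟩ ⟨h, hh, ht⟩
        refine ⟨g * h, H.mul_mem hg hh, ?_⟩
        rw [ofAdd_add, map_mul, map_mul]
        rcases hs with hs | hs <;> rcases ht with ht | ht <;> simp [hs, ht]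
      neg_mem' := by
        rintro s ⟨g, hg, hs⟩
        refine ⟨g⁻¹, H.inv_mem hg, ?_⟩
        rw [ofAdd_neg, map_inv, map_inv]
        rcases hs with hs | hs
        · simp [hs]
        · right
          rw [hs, inv_eq_iff_mul_eq_one]
          simp }
  have hiso : ∀ᶠ t : ℝ in 𝓝 0, t ∈ A → t = 0 := by
    have h2 : Tendsto (fun t : ℝ => 2 * t) (𝓝 0) (𝓝 0) := by
      have : Continuous fun t : ℝ => 2 * t := by fun_prop
      simpa using this.tendsto 0
    have hE0 : Tendsto (fun t : ℝ => (E (.ofAdd t)).1) (𝓝 0) (𝓝 1) := by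
      simpa using hcont.tendsto 0
    filter_upwards [h2.eventually hinj, (hE0.comp h2).eventually hd] with t h1 h3
    rintro ⟨g, hg, hs⟩
    have hsq : ρ (g * g) = E (.ofAdd (2 * t)) := by
      rw [two_mul, ofAdd_add, map_mul, map_mul]
      rcases hs with hs | hs <;> simp [hs]
    have h4 := h3 (g * g) (by rw [hsq]; rfl)
    have := h1 (hsq ▸ h4)
    linarith
  rcases AddSubgroup.dense_or_cyclic A with hA | ⟨t₀, hA⟩
  · exfalso
    obtain ⟨ε, hε, hball⟩ := Metric.eventually_nhds_iff.1 hiso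
    obtain ⟨x, hxA, hx⟩ := hA.exists_between hε
    have := hball (y := x) (by rw [Real.dist_eq, sub_zero, abs_of_pos hx.1]; exact hx.2) hxA
    exact hx.1.ne' this
  · have ht₀ : t₀ ∈ A := hA ▸ AddSubgroup.subset_closure rfl
    obtain ⟨h₀, hh₀, hs₀⟩ := ht₀
    refine ⟨H, hH, h₀, fun h hh => ?_⟩
    obtain ⟨t, ht⟩ := hE h hh
    have htA : t ∈ A := ⟨h, hh, ht⟩
    rw [hA, AddSubgroup.mem_closure_singleton] at htA
    obtain ⟨k, rfl⟩ := htA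
    refine ⟨k, ?_⟩
    rw [ofAdd_zsmul, map_zpow] at ht
    rcases hs₀ with hs₀ | hs₀
    · rwa [hs₀]
    · rw [hs₀]
      rcases Int.even_or_odd k with hk | hk
      · rwa [hk.neg_zpow]
      · rw [hk.neg_zpow, neg_neg]
        exact ht.symm

/-- Non-arithmeticity along a ray: if the translation lengths for the traces
`a * l ^ n + d / l ^ n` lie in a discrete subgroup, then `a * d = 1`. -/
lemma mul_eq_one_of_pos_of_translationLength {l a d α : ℝ} (hl : 1 < l) (ha : 0 < a)
    (hlα : ∃ k : ℤ, 2 * Real.log l = k * α)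
    (hlen : ∀ n : ℕ, 2 < |a * l ^ n + d * (l⁻¹) ^ n| →
      ∃ k : ℤ, translationLength (a * l ^ n + d * (l⁻¹) ^ n) = k * α) :
    a * d = 1 := by
  have hl0 : 0 < l := by linarith
  set t : ℕ → ℝ := fun n => a * l ^ n + d * (l⁻¹) ^ n with ht
  have hx : Tendsto (fun n : ℕ => (l⁻¹) ^ n) atTop (𝓝 0) :=
    tendsto_pow_atTop_nhds_zero_of_lt_one (by positivity) (inv_lt_one_of_one_lt₀ hl)
  have htlim : Tendsto t atTop atTop := by
    apply Tendsto.atTop_add (C := d * 0)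
    · exact (tendsto_pow_atTop_atTop_of_one_lt hl).const_mul_atTop ha
    · exact hx.const_mul d
  have hmul : ∀ n : ℕ, l ^ n * (l⁻¹) ^ n = 1 := fun n => by
    rw [← mul_pow, mul_inv_cancel₀ hl0.ne', one_pow]
  have hratio : ∀ᶠ n in atTop, translationLength (t n) - 2 * n * Real.log l
      = 2 * Real.log (((a + d * ((l⁻¹) ^ n) ^ 2)
        + Real.sqrt ((a + d * ((l⁻¹) ^ n) ^ 2) ^ 2 - 4 * ((l⁻¹) ^ n) ^ 2)) / 2) := by
    filter_upwards [htlim.eventually_gt_atTop 2] with n hn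
    have hp : 0 < l ^ n := by positivity
    have hq : 0 < (l⁻¹) ^ n := by positivity
    have h1 : (a + d * ((l⁻¹) ^ n) ^ 2) = t n * (l⁻¹) ^ n := by
      simp only [ht]
      linear_combination -a * hmul n
    have h2 : (a + d * ((l⁻¹) ^ n) ^ 2) ^ 2 - 4 * ((l⁻¹) ^ n) ^ 2
        = (t n ^ 2 - 4) * ((l⁻¹) ^ n) ^ 2 := by rw [h1]; ring
    rw [h2, Real.sqrt_mul' _ (by positivity), Real.sqrt_sq hq.le, h1, translationLength,
      abs_of_pos (by linarith)]
    have h3 : (t n * (l⁻¹) ^ n + Real.sqrt (t n ^ 2 - 4) * (l⁻¹) ^ n) / 2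
        = ((t n + Real.sqrt (t n ^ 2 - 4)) / 2) * (l⁻¹) ^ n := by ring
    rw [h3, Real.log_mul (by have := Real.sqrt_nonneg (t n ^ 2 - 4); positivity) hq.ne',
      Real.log_pow, Real.log_inv]
    ring
  have hlim : Tendsto (fun n : ℕ => translationLength (t n) - 2 * n * Real.log l) atTop
      (𝓝 (2 * Real.log a)) := by
    refine Tendsto.congr' (EventuallyEq.symm hratio) ?_
    have hc : Continuous fun x : ℝ =>
        ((a + d * x ^ 2) + Real.sqrt ((a + d * x ^ 2) ^ 2 - 4 * x ^ 2)) / 2 := by fun_prop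
    have h0 := hc.tendsto 0
    have : ((a + d * 0 ^ 2) + Real.sqrt ((a + d * 0 ^ 2) ^ 2 - 4 * 0 ^ 2)) / 2 = a := by
      norm_num [Real.sqrt_sq ha.le]
    rw [this] at h0
    exact ((h0.comp hx).log ha.ne').const_mul 2
  have hint : ∀ᶠ n in atTop, ∃ k : ℤ,
      translationLength (t n) - 2 * (n : ℕ) * Real.log l = k * α := by
    filter_upwards [htlim.eventually_gt_atTop 2] with n hn
    obtain ⟨k, hk⟩ := hlen n (lt_of_lt_of_le hn (le_abs_self _))
    obtain ⟨j, hj⟩ := hlα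
    refine ⟨k - n * j, ?_⟩
    push_cast
    linear_combination hk - n * hj
  have hclosed : ∀ᶠ n in atTop, translationLength (t n) - 2 * (n : ℕ) * Real.log l
      = 2 * Real.log a := by
    have hmem : ∀ᶠ n in atTop, translationLength (t n) - 2 * (n : ℕ) * Real.log l
        ∈ AddSubgroup.zmultiples α := by
      filter_upwards [hint] with n ⟨k, hk⟩
      exact ⟨k, by rw [hk]; simp⟩
    have hcl : 2 * Real.log a ∈ AddSubgroup.zmultiples α :=
      (AddSubgroup.isClosed_of_discrete (H := AddSubgroup.zmultiples α)).mem_of_tendsto hlim hmem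
    obtain ⟨U, hU, hUA⟩ := nhds_inter_eq_singleton_of_mem_discrete
      (s := (AddSubgroup.zmultiples α : Set ℝ))
      (SetLike.isDiscrete_iff_discreteTopology.2 inferInstance) hcl
    filter_upwards [hmem, hlim.eventually hU] with n h1 h2
    have : _ ∈ U ∩ (AddSubgroup.zmultiples α : Set ℝ) := ⟨h2, h1⟩
    rw [hUA] at this
    exact this
  obtain ⟨n, hn, ht2⟩ := (hclosed.and (htlim.eventually_gt_atTop 2)).exists
  have hp : 0 < l ^ n := by positivity
  have hs := Real.sqrt_nonneg (t n ^ 2 - 4)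
  have hsq := Real.sq_sqrt (show 0 ≤ t n ^ 2 - 4 by nlinarith)
  have hμ : (t n + Real.sqrt (t n ^ 2 - 4)) / 2 = a * l ^ n := by
    apply Real.log_injOn_pos (Set.mem_Ioi.2 (by linarith)) (Set.mem_Ioi.2 (by positivity))
    rw [Real.log_mul ha.ne' hp.ne', Real.log_pow]
    rw [translationLength, abs_of_pos (by linarith)] at hn
    linarith
  have hquad : (a * l ^ n) ^ 2 - t n * (a * l ^ n) + 1 = 0 := by
    rw [← hμ]
    linear_combination hsq / 4
  simp only [ht] at hquad
  linear_combination -hquad - a * d * hmul n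

lemma mul_eq_one_of_translationLength {l a d α : ℝ} (hl : 1 < l) (ha : a ≠ 0)
    (hlα : ∃ k : ℤ, 2 * Real.log l = k * α)
    (hlen : ∀ n : ℕ, 2 < |a * l ^ n + d * (l⁻¹) ^ n| →
      ∃ k : ℤ, translationLength (a * l ^ n + d * (l⁻¹) ^ n) = k * α) :
    a * d = 1 := by
  rcases ha.lt_or_gt with ha | ha
  · rw [← neg_mul_neg]
    refine mul_eq_one_of_pos_of_translationLength hl (neg_pos.2 ha) hlα fun n hn => ?_
    have h : -a * l ^ n + -d * (l⁻¹) ^ n = -(a * l ^ n + d * (l⁻¹) ^ n) := by ring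
    rw [h, abs_neg] at hn
    rw [h, translationLength, abs_neg, neg_sq]
    exact hlen n hn
  · exact mul_eq_one_of_pos_of_translationLength hl ha hlα hlen

lemma translationLength_add_inv {l : ℝ} (hl : 1 < l) :
    translationLength (l + l⁻¹) = 2 * Real.log l := by
  have hl0 : 0 < l := by linarith
  have h1 : l⁻¹ < 1 := inv_lt_one_of_one_lt₀ hl
  have h2 : (l + l⁻¹) ^ 2 - 4 = (l - l⁻¹) ^ 2 := by
    linear_combination 4 * mul_inv_cancel₀ hl0.ne'
  rw [translationLength, h2, Real.sqrt_sq (by linarith), abs_of_pos (by positivity)]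
  congr 2
  ring

lemma SL2R.mul_sub_mul_eq_one (M : SL2R) : M.1 0 0 * M.1 1 1 - M.1 0 1 * M.1 1 0 = 1 := by
  rw [← Matrix.det_fin_two, M.2]

/-- The matrix with rows `(a, b)` and `(c, d)`. -/
def SL2R.mk (a b c d : ℝ) (h : a * d - b * c = 1) : SL2R :=
  ⟨!![a, b; c, d], by rw [Matrix.det_fin_two_of, h]⟩

lemma SL2R.mk_val (a b c d : ℝ) (h : a * d - b * c = 1) :
    (SL2R.mk a b c d h).1 = !![a, b; c, d] := rfl

lemma SL2R.mk_conj_val (a b c d : ℝ) (h : a * d - b * c = 1) (M : SL2R) :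
    (SL2R.mk a b c d h * M * (SL2R.mk a b c d h)⁻¹).1 =
      !![(a * M.1 0 0 + b * M.1 1 0) * d - (a * M.1 0 1 + b * M.1 1 1) * c,
        -(a * M.1 0 0 + b * M.1 1 0) * b + (a * M.1 0 1 + b * M.1 1 1) * a;
        (c * M.1 0 0 + d * M.1 1 0) * d - (c * M.1 0 1 + d * M.1 1 1) * c,
        -(c * M.1 0 0 + d * M.1 1 0) * b + (c * M.1 0 1 + d * M.1 1 1) * a] := by
  rw [Matrix.SpecialLinearGroup.coe_mul, Matrix.SpecialLinearGroup.coe_mul,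
    Matrix.SpecialLinearGroup.coe_inv, SL2R.mk_val, Matrix.adjugate_fin_two_of]
  ext i j
  rw [Matrix.mul_apply, Fin.sum_univ_two, Matrix.mul_apply, Matrix.mul_apply,
    Fin.sum_univ_two, Fin.sum_univ_two]
  fin_cases i <;> fin_cases j <;> simp <;> ring

lemma SL2R.exists_conj_upper (M : SL2R) (hM : 4 ≤ M.1.trace ^ 2) :
    ∃ P : SL2R, (P * M * P⁻¹).1 1 0 = 0 := by
  by_cases hc : M.1 1 0 = 0
  · exact ⟨1, by simpa using hc⟩
  rw [Matrix.trace_fin_two] at hM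
  have hdet := M.mul_sub_mul_eq_one
  have hsq := Real.sq_sqrt (show 0 ≤ (M.1 0 0 + M.1 1 1) ^ 2 - 4 by linarith)
  set s := Real.sqrt ((M.1 0 0 + M.1 1 1) ^ 2 - 4)
  refine ⟨SL2R.mk 0 1 (-1) (((M.1 0 0 + M.1 1 1 + s) / 2 - M.1 1 1) / M.1 1 0) (by ring), ?_⟩
  rw [SL2R.mk_conj_val]
  simp only [Matrix.of_apply, Matrix.cons_val', Matrix.cons_val_zero, Matrix.cons_val_one,
    Matrix.cons_val_fin_one]
  field_simp
  linear_combination hsq + 4 * hdet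

lemma SL2R.exists_conj_diagonal (M : SL2R) (hM : 2 < |M.1.trace|) :
    ∃ P : SL2R, (P * M * P⁻¹).1 0 1 = 0 ∧ (P * M * P⁻¹).1 1 0 = 0 := by
  have h4 : 4 < M.1.trace ^ 2 := by
    rw [← sq_abs]
    nlinarith
  obtain ⟨P, hP⟩ := M.exists_conj_upper h4.le
  have htr : (P * M * P⁻¹).1.trace = M.1.trace := trace_conjRep P (MonoidHom.id SL2R) M
  set N := P * M * P⁻¹ with hN
  rw [← htr, Matrix.trace_fin_two] at h4
  have hdet := N.mul_sub_mul_eq_one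
  rw [hP, mul_zero, sub_zero] at hdet
  have hne : N.1 0 0 - N.1 1 1 ≠ 0 := by
    intro h
    have := pow_eq_zero_iff (two_ne_zero) |>.2 h
    nlinarith
  refine ⟨SL2R.mk 1 (N.1 0 1 / (N.1 0 0 - N.1 1 1)) 0 1 (by ring) * P, ?_⟩
  have hassoc : ∀ Q : SL2R, Q * P * M * (Q * P)⁻¹ = Q * N * Q⁻¹ := fun Q => by
    simp [hN, mul_assoc]
  rw [hassoc, SL2R.mk_conj_val]
  constructor
  · simp [hP]
    field_simp
    ring
  · simp [hP]

lemma SL2R.exists_conj_rotation (M : SL2R) (hM : M.1.trace ^ 2 < 4) :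
    ∃ P : SL2R, (P * M * P⁻¹).1 0 0 = (P * M * P⁻¹).1 1 1 ∧
      (P * M * P⁻¹).1 0 1 = -(P * M * P⁻¹).1 1 0 := by
  rw [Matrix.trace_fin_two] at hM
  have hdet := M.mul_sub_mul_eq_one
  have hc : M.1 1 0 ≠ 0 := by
    intro h
    rw [h] at hdet
    nlinarith [sq_nonneg (M.1 0 0 - M.1 1 1)]
  obtain ⟨N, m, hm, ⟨P, rfl⟩, h00, h11, h10⟩ : ∃ (N : SL2R) (m : ℝ), m ^ 2 < 1 ∧
      (∃ P : SL2R, P * M * P⁻¹ = N) ∧ N.1 0 0 = m ∧ N.1 1 1 = m ∧ N.1 1 0 ≠ 0 := by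
    refine ⟨_, (M.1 0 0 + M.1 1 1) / 2, by nlinarith,
      ⟨SL2R.mk 1 (-((M.1 0 0 - M.1 1 1) / (2 * M.1 1 0))) 0 1 (by ring), rfl⟩, ?_, ?_, ?_⟩
    · rw [SL2R.mk_conj_val]
      simp
      field_simp
      ring
    · rw [SL2R.mk_conj_val]
      simp
      field_simp
      ring
    · rw [SL2R.mk_conj_val]
      simpa using hc
  set N := P * M * P⁻¹ with hN
  have hdet := N.mul_sub_mul_eq_one
  rw [h00, h11] at hdet
  have hneg : N.1 0 1 * N.1 1 0 < 0 := by nlinarith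
  have hpos : 0 < -N.1 1 0 / N.1 0 1 := by
    have h0 : N.1 0 1 ≠ 0 := by
      intro h
      simp [h] at hneg
    have : -N.1 1 0 / N.1 0 1 = -(N.1 0 1 * N.1 1 0) / N.1 0 1 ^ 2 := by field_simp
    rw [this]
    have : 0 < N.1 0 1 ^ 2 := by positivity
    exact div_pos (by linarith) this
  obtain ⟨s, hs, hs4⟩ : ∃ s : ℝ, 0 < s ∧ s ^ 4 = -N.1 1 0 / N.1 0 1 := by
    refine ⟨√√(-N.1 1 0 / N.1 0 1), by positivity, ?_⟩
    rw [show 4 = 2 * 2 by norm_num, pow_mul, Real.sq_sqrt (by positivity), Real.sq_sqrt hpos.le]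
  have h0 : N.1 0 1 ≠ 0 := by
    intro h
    simp [h] at hneg
  refine ⟨SL2R.mk s 0 0 s⁻¹ (by field_simp; ring) * P, ?_⟩
  have hassoc : ∀ Q : SL2R, Q * P * M * (Q * P)⁻¹ = Q * N * Q⁻¹ := fun Q => by
    simp [hN, mul_assoc]
  rw [hassoc, SL2R.mk_conj_val]
  constructor
  · simp [h00, h11]
    field_simp
  · simp
    field_simp
    rw [eq_div_iff h0] at hs4
    linear_combination hs4

/-- The group of diagonal matrices with positive entries. -/
noncomputable def SL2R.diagHom : Multiplicative ℝ →* SL2R where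
  toFun t := SL2R.mk (Real.exp t.toAdd) 0 0 (Real.exp (-t.toAdd)) (by simp [← Real.exp_add])
  map_one' := by
    ext i j
    fin_cases i <;> fin_cases j <;> simp [SL2R.mk]
  map_mul' s t := by
    ext i j
    simp only [Matrix.SpecialLinearGroup.coe_mul, SL2R.mk_val]
    fin_cases i <;> fin_cases j <;>
      simp [Real.exp_add, mul_comm]

/-- The group of upper unipotent matrices. -/
def SL2R.unipotentHom : Multiplicative ℝ →* SL2R where
  toFun t := SL2R.mk 1 t.toAdd 0 1 (by ring)
  map_one' := by
    ext i j
    fin_cases i <;> fin_cases j <;> simp [SL2R.mk]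
  map_mul' s t := by
    ext i j
    simp only [Matrix.SpecialLinearGroup.coe_mul, SL2R.mk_val]
    fin_cases i <;> fin_cases j <;>
      simp [add_comm]

/-- The group of rotations. -/
noncomputable def SL2R.rotationHom : Multiplicative ℝ →* SL2R where
  toFun t := SL2R.mk (Real.cos t.toAdd) (-Real.sin t.toAdd) (Real.sin t.toAdd)
    (Real.cos t.toAdd) (by nlinarith [Real.sin_sq_add_cos_sq t.toAdd])
  map_one' := by
    ext i j
    fin_cases i <;> fin_cases j <;> simp [SL2R.mk]
  map_mul' s t := by
    ext i j
    simp only [Matrix.SpecialLinearGroup.coe_mul, SL2R.mk_val]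
    fin_cases i <;> fin_cases j <;>
      simp [Real.cos_add, Real.sin_add] <;> ring

lemma SL2R.diagHom_val (t : ℝ) :
    (SL2R.diagHom (.ofAdd t)).1 = !![Real.exp t, 0; 0, Real.exp (-t)] := rfl

lemma SL2R.unipotentHom_val (t : ℝ) :
    (SL2R.unipotentHom (.ofAdd t)).1 = !![1, t; 0, 1] := rfl

lemma SL2R.rotationHom_val (t : ℝ) :
    (SL2R.rotationHom (.ofAdd t)).1
      = !![Real.cos t, -Real.sin t; Real.sin t, Real.cos t] := rfl

lemma SL2R.ext_entries {M N : SL2R} (h00 : M.1 0 0 = N.1 0 0) (h01 : M.1 0 1 = N.1 0 1)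
    (h10 : M.1 1 0 = N.1 1 0) (h11 : M.1 1 1 = N.1 1 1) : M = N := by
  ext i j
  fin_cases i <;> fin_cases j <;> assumption

lemma IsDiscreteRep.isVirtuallyCyclicRep_of_diagonal {G : Type*} [Group G] {ρ : G →* SL2R}
    (hd : IsDiscreteRep ρ) (H : Subgroup G) (hH : H.FiniteIndex)
    (hE : ∀ h ∈ H, (ρ h).1 0 1 = 0 ∧ (ρ h).1 1 0 = 0) : IsVirtuallyCyclicRep ρ := by
  refine hd.isVirtuallyCyclicRep SL2R.diagHom ?_ ?_ H hH ?_
  · simp only [SL2R.diagHom_val]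
    fun_prop
  · filter_upwards with t ht
    have := congrArg (fun M : SL2R => M.1 0 0) ht
    simpa [SL2R.diagHom_val] using this
  · intro h hh
    obtain ⟨h01, h10⟩ := hE h hh
    have hdet := (ρ h).mul_sub_mul_eq_one
    rw [h01, zero_mul, sub_zero] at hdet
    have h0 : (ρ h).1 0 0 ≠ 0 := left_ne_zero_of_mul_eq_one hdet
    have h11 : (ρ h).1 1 1 = ((ρ h).1 0 0)⁻¹ := eq_inv_of_mul_eq_one_right hdet
    rcases h0.lt_or_gt with h0 | h0
    · refine ⟨Real.log (-(ρ h).1 0 0), Or.inr (SL2R.ext_entries ?_ ?_ ?_ ?_)⟩ <;>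
        rw [Matrix.SpecialLinearGroup.coe_neg, SL2R.diagHom_val, Real.exp_neg,
          Real.exp_log (neg_pos.2 h0)] <;> simp [*]
    · refine ⟨Real.log ((ρ h).1 0 0), Or.inl (SL2R.ext_entries ?_ ?_ ?_ ?_)⟩ <;>
        rw [SL2R.diagHom_val, Real.exp_neg, Real.exp_log h0] <;> simp [*]

lemma IsDiscreteRep.isVirtuallyCyclicRep_of_unipotent {G : Type*} [Group G] {ρ : G →* SL2R}
    (hd : IsDiscreteRep ρ)
    (hE : ∀ h, (ρ h).1 1 0 = 0 ∧ (ρ h).1 0 0 = (ρ h).1 1 1) : IsVirtuallyCyclicRep ρ := by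
  refine hd.isVirtuallyCyclicRep SL2R.unipotentHom ?_ ?_ ⊤ inferInstance ?_
  · simp only [SL2R.unipotentHom_val]
    fun_prop
  · filter_upwards with t ht
    have := congrArg (fun M : SL2R => M.1 0 1) ht
    simpa [SL2R.unipotentHom_val] using this
  · intro h _
    obtain ⟨h10, h11⟩ := hE h
    have hdet := (ρ h).mul_sub_mul_eq_one
    rw [h10, mul_zero, sub_zero, h11, mul_self_eq_one_iff] at hdet
    rcases hdet with hdet | hdet
    · refine ⟨(ρ h).1 0 1, Or.inl (SL2R.ext_entries ?_ ?_ ?_ ?_)⟩ <;>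
        rw [SL2R.unipotentHom_val] <;> simp [*]
    · refine ⟨-(ρ h).1 0 1, Or.inr (SL2R.ext_entries ?_ ?_ ?_ ?_)⟩ <;>
        rw [Matrix.SpecialLinearGroup.coe_neg, SL2R.unipotentHom_val] <;> simp [*]

lemma IsDiscreteRep.isVirtuallyCyclicRep_of_rotation {G : Type*} [Group G] {ρ : G →* SL2R}
    (hd : IsDiscreteRep ρ)
    (hE : ∀ h, (ρ h).1 0 0 = (ρ h).1 1 1 ∧ (ρ h).1 0 1 = -(ρ h).1 1 0) :
    IsVirtuallyCyclicRep ρ := by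
  refine hd.isVirtuallyCyclicRep SL2R.rotationHom ?_ ?_ ⊤ inferInstance ?_
  · simp only [SL2R.rotationHom_val]
    fun_prop
  · filter_upwards [Ioo_mem_nhds (neg_lt_zero.2 Real.pi_pos) Real.pi_pos] with t hpi ht
    have := congrArg (fun M : SL2R => M.1 1 0) ht
    simp only [SL2R.rotationHom_val, Matrix.SpecialLinearGroup.coe_one] at this
    exact (Real.sin_eq_zero_iff_of_lt_of_lt hpi.1 hpi.2).1 (by simpa using this)
  · intro h _
    obtain ⟨h11, h01⟩ := hE h
    have hdet := (ρ h).mul_sub_mul_eq_one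
    rw [h01, ← h11] at hdet
    set z : ℂ := ⟨(ρ h).1 0 0, (ρ h).1 1 0⟩ with hz
    have hnorm : ‖z‖ = 1 := by
      rw [← sq_eq_sq₀ (norm_nonneg _) zero_le_one, ← Complex.normSq_eq_norm_sq, Complex.normSq_mk]
      linarith
    have hz0 : z ≠ 0 := norm_ne_zero_iff.1 (by rw [hnorm]; exact one_ne_zero)
    have hcos : Real.cos z.arg = (ρ h).1 0 0 := by rw [Complex.cos_arg hz0, hnorm, div_one]
    have hsin : Real.sin z.arg = (ρ h).1 1 0 := by rw [Complex.sin_arg, hnorm, div_one]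
    refine ⟨z.arg, Or.inl (SL2R.ext_entries ?_ ?_ ?_ ?_)⟩ <;>
      rw [SL2R.rotationHom_val, hcos, hsin] <;> simp [*]

lemma SL2R.val_pow_diagonal {M : SL2R} {l : ℝ} (hM : M.1 = !![l, 0; 0, l⁻¹]) (n : ℕ) :
    (M ^ n).1 = !![l ^ n, 0; 0, l⁻¹ ^ n] := by
  induction n with
  | zero => ext i j; fin_cases i <;> fin_cases j <;> simp
  | succ n ih =>
    rw [pow_succ, Matrix.SpecialLinearGroup.coe_mul, ih, hM]
    ext i j
    fin_cases i <;> fin_cases j <;> simp [pow_succ]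

lemma SL2R.val_inv_diagonal {M : SL2R} {l : ℝ} (hM : M.1 = !![l, 0; 0, l⁻¹]) :
    (M⁻¹).1 = !![l⁻¹, 0; 0, l] := by
  rw [Matrix.SpecialLinearGroup.coe_inv, hM, Matrix.adjugate_fin_two_of, neg_zero]

lemma SL2R.val_inv_pow_diagonal {M : SL2R} {l : ℝ} (hM : M.1 = !![l, 0; 0, l⁻¹]) (n : ℕ) :
    ((M ^ n)⁻¹).1 = !![l⁻¹ ^ n, 0; 0, l ^ n] := by
  rw [Matrix.SpecialLinearGroup.coe_inv, SL2R.val_pow_diagonal hM, Matrix.adjugate_fin_two_of,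
    neg_zero]

lemma tendsto_inv_pow_mul_inv_pow {l : ℝ} (hl : 1 < l) (x : ℝ) :
    Tendsto (fun n : ℕ => l⁻¹ ^ n * x * l⁻¹ ^ n) atTop (𝓝 0) := by
  have h : Tendsto (fun n : ℕ => l⁻¹ ^ n) atTop (𝓝 0) :=
    tendsto_pow_atTop_nhds_zero_of_lt_one (by positivity) (inv_lt_one_of_one_lt₀ hl)
  simpa using (h.mul_const x).mul h

/-- A discrete representation contains no upper unipotent element fixing the attracting point of
a hyperbolic element. -/
lemma IsDiscreteRep.upper_eq_zero {G : Type*} [Group G] {ρ : G →* SL2R} (hd : IsDiscreteRep ρ)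
    {g u : G} {l x : ℝ} (hl : 1 < l) (hg : (ρ g).1 = !![l, 0; 0, l⁻¹])
    (hu : (ρ u).1 = !![1, x; 0, 1]) : x = 0 := by
  have hl0 : l ≠ 0 := by positivity
  obtain ⟨n, hn⟩ := hd.exists_eq_one (g := fun n => (g ^ n)⁻¹ * u * g ^ n)
    (m := fun n => !![1, l⁻¹ ^ n * x * l⁻¹ ^ n; 0, 1])
    (fun n => by
      rw [map_mul, map_mul, map_inv, map_pow, Matrix.SpecialLinearGroup.coe_mul,
        Matrix.SpecialLinearGroup.coe_mul, SL2R.val_inv_pow_diagonal hg,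
        SL2R.val_pow_diagonal hg, hu]
      ext i j
      fin_cases i <;> fin_cases j <;> simp [hl0])
    (by
      have hc : Continuous fun y : ℝ => (!![1, y; 0, 1] : Matrix (Fin 2) (Fin 2) ℝ) := by fun_prop
      have := (hc.tendsto 0).comp (tendsto_inv_pow_mul_inv_pow hl x)
      rwa [← Matrix.one_fin_two] at this)
  have := congrFun (congrFun hn 0) 1
  simpa [hl0] using this

/-- A discrete representation contains no lower unipotent element fixing the repelling point of
a hyperbolic element. -/
lemma IsDiscreteRep.lower_eq_zero {G : Type*} [Group G] {ρ : G →* SL2R} (hd : IsDiscreteRep ρ)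
    {g u : G} {l x : ℝ} (hl : 1 < l) (hg : (ρ g).1 = !![l, 0; 0, l⁻¹])
    (hu : (ρ u).1 = !![1, 0; x, 1]) : x = 0 := by
  have hl0 : l ≠ 0 := by positivity
  obtain ⟨n, hn⟩ := hd.exists_eq_one (g := fun n => g ^ n * u * (g ^ n)⁻¹)
    (m := fun n => !![1, 0; l⁻¹ ^ n * x * l⁻¹ ^ n, 1])
    (fun n => by
      rw [map_mul, map_mul, map_inv, map_pow, Matrix.SpecialLinearGroup.coe_mul,
        Matrix.SpecialLinearGroup.coe_mul, SL2R.val_inv_pow_diagonal hg,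
        SL2R.val_pow_diagonal hg, hu]
      ext i j
      fin_cases i <;> fin_cases j <;> simp [hl0])
    (by
      have hc : Continuous fun y : ℝ => (!![1, 0; y, 1] : Matrix (Fin 2) (Fin 2) ℝ) := by fun_prop
      have := (hc.tendsto 0).comp (tendsto_inv_pow_mul_inv_pow hl x)
      rwa [← Matrix.one_fin_two] at this)
  have := congrFun (congrFun hn 1) 0
  simpa [hl0] using this

lemma SL2R.val_commutator_diagonal {M N : SL2R} {l : ℝ} (hM : M.1 = !![l, 0; 0, l⁻¹]) :
    (N * M * N⁻¹ * M⁻¹).1 =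
      !![(N.1 0 0 * l * N.1 1 1 - N.1 0 1 * l⁻¹ * N.1 1 0) * l⁻¹,
        N.1 0 0 * N.1 0 1 * (l⁻¹ - l) * l;
        N.1 1 0 * N.1 1 1 * (l - l⁻¹) * l⁻¹,
        (N.1 0 0 * l⁻¹ * N.1 1 1 - N.1 0 1 * l * N.1 1 0) * l] := by
  rw [Matrix.SpecialLinearGroup.coe_mul, Matrix.SpecialLinearGroup.coe_mul,
    Matrix.SpecialLinearGroup.coe_mul, SL2R.val_inv_diagonal hM, hM,
    Matrix.SpecialLinearGroup.coe_inv, Matrix.adjugate_fin_two]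
  conv_lhs => rw [Matrix.eta_fin_two N.1]
  ext i j
  fin_cases i <;> fin_cases j <;>
    simp [-mul_eq_mul_right_iff, -mul_eq_mul_left_iff] <;> ring

lemma SL2R.trace_diagonal_mul {l m : ℝ} (N : Matrix (Fin 2) (Fin 2) ℝ) :
    (!![l, 0; 0, m] * N).trace = N 0 0 * l + N 1 1 * m := by
  rw [Matrix.trace_fin_two, Matrix.mul_apply, Matrix.mul_apply, Fin.sum_univ_two,
    Fin.sum_univ_two]
  simp
  ring

/-- If the translation lengths lie in a discrete group, then every element preserves the axis of
a given hyperbolic element. -/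
lemma IsDiscreteRep.diagonal_or_antidiagonal {G : Type*} [Group G] {ρ : G →* SL2R}
    (hd : IsDiscreteRep ρ) {α : ℝ} (hα : HasLengthsIn ρ α) {g : G} {l : ℝ} (hl : 1 < l)
    (hg : (ρ g).1 = !![l, 0; 0, l⁻¹]) (h : G) :
    ((ρ h).1 0 1 = 0 ∧ (ρ h).1 1 0 = 0) ∨ ((ρ h).1 0 0 = 0 ∧ (ρ h).1 1 1 = 0) := by
  have hl0 : 0 < l := by linarith
  have hl1 : l⁻¹ < 1 := inv_lt_one_of_one_lt₀ hl
  have htr : ∀ n : ℕ, (ρ (g ^ n * h)).1.trace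
      = (ρ h).1 0 0 * l ^ n + (ρ h).1 1 1 * l⁻¹ ^ n := fun n => by
    rw [map_mul, map_pow, Matrix.SpecialLinearGroup.coe_mul, SL2R.val_pow_diagonal hg,
      SL2R.trace_diagonal_mul]
  have htr' : ∀ n : ℕ, (ρ ((g ^ n)⁻¹ * h)).1.trace
      = (ρ h).1 1 1 * l ^ n + (ρ h).1 0 0 * l⁻¹ ^ n := fun n => by
    rw [map_mul, map_inv, map_pow, Matrix.SpecialLinearGroup.coe_mul,
      SL2R.val_inv_pow_diagonal hg, SL2R.trace_diagonal_mul, add_comm]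
  have hlα : ∃ k : ℤ, 2 * Real.log l = k * α := by
    have htg : (ρ g).1.trace = l + l⁻¹ := by rw [hg, Matrix.trace_fin_two_of]
    obtain ⟨k, hk⟩ := hα g (by
      rw [htg, abs_of_pos (by positivity)]
      nlinarith [mul_inv_cancel₀ hl0.ne', mul_pos (sub_pos.2 hl) (sub_pos.2 hl1)])
    exact ⟨k, by rw [← hk, htg, translationLength_add_inv hl]⟩
  have hdet := (ρ h).mul_sub_mul_eq_one
  have key : (ρ h).1 0 0 * (ρ h).1 1 1 = 1 ∨ ((ρ h).1 0 0 = 0 ∧ (ρ h).1 1 1 = 0) := by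
    by_cases h00 : (ρ h).1 0 0 = 0
    · by_cases h11 : (ρ h).1 1 1 = 0
      · exact Or.inr ⟨h00, h11⟩
      · left
        rw [mul_comm]
        refine mul_eq_one_of_translationLength hl h11 hlα fun n hn => ?_
        rw [← htr'] at hn ⊢
        exact hα _ hn
    · left
      refine mul_eq_one_of_translationLength hl h00 hlα fun n hn => ?_
      rw [← htr] at hn ⊢
      exact hα _ hn
  refine key.imp (fun had => ?_) id
  have hbc : (ρ h).1 0 1 * (ρ h).1 1 0 = 0 := by linarith
  have hcomm := SL2R.val_commutator_diagonal (N := ρ h) hg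
  rw [← map_inv, ← map_inv, ← map_mul, ← map_mul, ← map_mul] at hcomm
  have h00 : (ρ h).1 0 0 ≠ 0 := left_ne_zero_of_mul_eq_one had
  have h11 : (ρ h).1 1 1 ≠ 0 := right_ne_zero_of_mul_eq_one had
  have hone : ((ρ h).1 0 0 * l * (ρ h).1 1 1 - (ρ h).1 0 1 * l⁻¹ * (ρ h).1 1 0) * l⁻¹ = 1 := by
    linear_combination l * l⁻¹ * had - l⁻¹ * l⁻¹ * hbc + mul_inv_cancel₀ hl0.ne'
  have hone' : ((ρ h).1 0 0 * l⁻¹ * (ρ h).1 1 1 - (ρ h).1 0 1 * l * (ρ h).1 1 0) * l = 1 := by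
    linear_combination l * l⁻¹ * had - l * l * hbc + mul_inv_cancel₀ hl0.ne'
  rw [hone, hone'] at hcomm
  have hne : l - l⁻¹ ≠ 0 := by linarith
  have hne' : l⁻¹ - l ≠ 0 := by linarith
  rcases mul_eq_zero.1 hbc with hb | hc
  · refine ⟨hb, ?_⟩
    have := hd.lower_eq_zero hl hg (hcomm.trans (by rw [hb]; simp; rfl))
    simpa [h11, hne, hl0.ne'] using this
  · refine ⟨?_, hc⟩
    have := hd.upper_eq_zero hl hg (hcomm.trans (by rw [hc]; simp; rfl))
    simpa [h00, hne', hl0.ne'] using this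

/-- The subgroup of elements represented by diagonal matrices. -/
def diagonalSubgroup {G : Type*} [Group G] (ρ : G →* SL2R) : Subgroup G where
  carrier := {h | (ρ h).1 0 1 = 0 ∧ (ρ h).1 1 0 = 0}
  one_mem' := by simp
  mul_mem' {g h} hg hh := by
    simp only [Set.mem_ofPred_eq] at *
    simp [Matrix.mul_apply, hg, hh]
  inv_mem' {g} hg := by
    simp only [Set.mem_ofPred_eq] at *
    simp [Matrix.adjugate_fin_two, hg]

lemma diagonalSubgroup_finiteIndex {G : Type*} [Group G] (ρ : G →* SL2R)
    (h : ∀ h, ((ρ h).1 0 1 = 0 ∧ (ρ h).1 1 0 = 0) ∨ ((ρ h).1 0 0 = 0 ∧ (ρ h).1 1 1 = 0)) :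
    (diagonalSubgroup ρ).FiniteIndex := by
  by_cases htop : diagonalSubgroup ρ = ⊤
  · rw [htop]
    infer_instance
  obtain ⟨g, hg⟩ : ∃ g, g ∉ diagonalSubgroup ρ := by
    by_contra! hall
    exact htop (eq_top_iff.2 fun g _ => hall g)
  have hanti := (h g).resolve_left hg
  have h2 : (diagonalSubgroup ρ).index = 2 := by
    rw [Subgroup.index_eq_two_iff]
    refine ⟨g, fun b => ?_⟩
    by_cases hb : b ∈ diagonalSubgroup ρ
    · refine Or.inr ⟨hb, fun hbg => hg ?_⟩
      have := mul_mem (inv_mem hb) hbg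
      rwa [inv_mul_cancel_left] at this
    · refine Or.inl ⟨?_, hb⟩
      have hb' := (h b).resolve_left hb
      change (ρ (b * g)).1 0 1 = 0 ∧ (ρ (b * g)).1 1 0 = 0
      simp [Matrix.mul_apply, hanti, hb']
  exact ⟨by rw [h2]; exact two_ne_zero⟩

lemma IsDiscreteRep.isVirtuallyCyclicRep_of_hyperbolic {G : Type*} [Group G] {ρ : G →* SL2R}
    (hd : IsDiscreteRep ρ) {α : ℝ} (hα : HasLengthsIn ρ α) {g : G}
    (hg : 2 < |(ρ g).1.trace|) : IsVirtuallyCyclicRep ρ := by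
  obtain ⟨P, hP⟩ := (ρ g).exists_conj_diagonal hg
  apply IsVirtuallyCyclicRep.of_conj (P := P)
  rw [← trace_conjRep P] at hg
  replace hd := hd.conj P
  replace hα := hα.conj P
  rw [← conjRep_apply] at hP
  generalize conjRep P ρ = ρ at *
  obtain ⟨h01, h10⟩ := hP
  have hdet := (ρ g).mul_sub_mul_eq_one
  rw [h01, zero_mul, sub_zero] at hdet
  rw [Matrix.trace_fin_two] at hg
  obtain ⟨g', l, hl, hg'⟩ : ∃ (g' : G) (l : ℝ), 1 < l ∧ (ρ g').1 = !![l, 0; 0, l⁻¹] := by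
    have h0 : (ρ g).1 0 0 ≠ 0 := left_ne_zero_of_mul_eq_one hdet
    have h11 : (ρ g).1 1 1 = ((ρ g).1 0 0)⁻¹ := eq_inv_of_mul_eq_one_right hdet
    have hval : (ρ g).1 = !![(ρ g).1 0 0, 0; 0, ((ρ g).1 0 0)⁻¹] := by
      rw [← h11]
      conv_lhs => rw [Matrix.eta_fin_two (ρ g).1, h01, h10]
    have hne : (ρ g).1 0 0 ^ 2 ≠ 1 := by
      intro h
      rw [sq, mul_self_eq_one_iff] at h
      rcases h with h | h <;> rw [h11, h] at hg <;> norm_num at hg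
    have hpos : 0 < (ρ g).1 0 0 ^ 2 := by positivity
    rcases hne.lt_or_gt with h | h
    · refine ⟨(g ^ 2)⁻¹, ((ρ g).1 0 0 ^ 2)⁻¹, (one_lt_inv₀ hpos).2 h, ?_⟩
      rw [map_inv, map_pow, SL2R.val_inv_pow_diagonal hval, inv_inv, inv_pow]
    · refine ⟨g ^ 2, (ρ g).1 0 0 ^ 2, h, ?_⟩
      rw [map_pow, SL2R.val_pow_diagonal hval, inv_pow]
  exact hd.isVirtuallyCyclicRep_of_diagonal (diagonalSubgroup ρ)
    (diagonalSubgroup_finiteIndex ρ (hd.diagonal_or_antidiagonal hα hl hg')) fun h hh => hh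

lemma IsDiscreteRep.isVirtuallyCyclicRep_of_parabolic {G : Type*} [Group G] {ρ : G →* SL2R}
    (hd : IsDiscreteRep ρ) (hell : ∀ g, |(ρ g).1.trace| ≤ 2) {g : G}
    (hg : (ρ g).1.trace ^ 2 = 4) (hg1 : ρ g ≠ 1) (hg2 : ρ g ≠ -1) :
    IsVirtuallyCyclicRep ρ := by
  obtain ⟨P, hP⟩ := (ρ g).exists_conj_upper hg.ge
  apply IsVirtuallyCyclicRep.of_conj (P := P)
  rw [← trace_conjRep P] at hg
  replace hell : ∀ g, |(conjRep P ρ g).1.trace| ≤ 2 := fun g => by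
    rw [trace_conjRep]
    exact hell g
  replace hd := hd.conj P
  have hg1' : conjRep P ρ g ≠ 1 := by rwa [conjRep_apply, Ne, conj_eq_one_iff]
  have hg2' : conjRep P ρ g ≠ -1 := by
    rw [conjRep_apply]
    intro h
    apply hg2
    have : P * ρ g * P⁻¹ = P * (-1) * P⁻¹ := by rw [h]; simp
    exact mul_left_cancel (mul_right_cancel this)
  rw [← conjRep_apply] at hP
  generalize conjRep P ρ = ρ at *
  have hdet := (ρ g).mul_sub_mul_eq_one
  rw [hP, mul_zero, sub_zero] at hdet
  rw [Matrix.trace_fin_two] at hg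
  have hdiag : (ρ g).1 0 0 = (ρ g).1 1 1 := by
    rw [← sub_eq_zero, ← sq_eq_zero_iff]
    linear_combination hg - 4 * hdet
  rw [← hdiag] at hdet
  have ht : (ρ g).1 0 1 ≠ 0 := by
    intro ht
    rcases mul_self_eq_one_iff.1 hdet with h | h
    · exact hg1' (SL2R.ext_entries (by simpa using h) (by simpa using ht) (by simpa using hP)
        (by rw [← hdiag]; simpa using h))
    · refine hg2' (SL2R.ext_entries ?_ ?_ ?_ ?_) <;>
        rw [Matrix.SpecialLinearGroup.coe_neg] <;> simp [h, ht, hP, ← hdiag]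
  set x := 2 * ((ρ g).1 0 0 * (ρ g).1 0 1) with hx
  have hx0 : x ≠ 0 :=
    mul_ne_zero two_ne_zero (mul_ne_zero (left_ne_zero_of_mul_eq_one hdet) ht)
  have hpow : ∀ n : ℕ, (ρ ((g ^ 2) ^ n)).1 = !![1, n * x; 0, 1] := by
    have hsq : (ρ (g ^ 2)).1 = !![1, x; 0, 1] := by
      rw [map_pow, sq, Matrix.SpecialLinearGroup.coe_mul, Matrix.eta_fin_two (ρ g).1, hP, ← hdiag,
        Matrix.mul_fin_two, hdet, hx]
      simp only [mul_zero, zero_mul, add_zero, zero_add]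
      congr 2
      ring_nf
    intro n
    induction n with
    | zero => ext i j; fin_cases i <;> fin_cases j <;> simp
    | succ n ih =>
      rw [pow_succ, map_mul, Matrix.SpecialLinearGroup.coe_mul, ih, hsq, Matrix.mul_fin_two]
      push_cast
      ext i j
      fin_cases i <;> fin_cases j <;> simp
      ring
  refine hd.isVirtuallyCyclicRep_of_unipotent fun h => ?_
  have htr : ∀ n : ℕ, (ρ ((g ^ 2) ^ n * h)).1.trace
      = (ρ h).1 0 0 + (ρ h).1 1 1 + n * (x * (ρ h).1 1 0) := fun n => by
    rw [map_mul, Matrix.SpecialLinearGroup.coe_mul, hpow, Matrix.trace_fin_two, Matrix.mul_apply,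
      Matrix.mul_apply, Fin.sum_univ_two, Fin.sum_univ_two]
    simp
    ring
  have h0 := hell h
  rw [Matrix.trace_fin_two] at h0
  have hc : (ρ h).1 1 0 = 0 := by
    by_contra hc
    obtain ⟨n, hn⟩ := exists_nat_gt (4 / |x * (ρ h).1 1 0|)
    rw [div_lt_iff₀ (abs_pos.2 (mul_ne_zero hx0 hc))] at hn
    have h1 := hell ((g ^ 2) ^ n * h)
    rw [htr] at h1
    have h2 : |(n : ℝ) * (x * (ρ h).1 1 0)| ≤ 4 := by
      rw [abs_le] at *
      constructor <;> linarith [h1.1, h1.2, h0.1, h0.2]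
    rw [abs_mul, Nat.abs_cast] at h2
    linarith
  refine ⟨hc, ?_⟩
  have hdet := (ρ h).mul_sub_mul_eq_one
  rw [hc, mul_zero, sub_zero] at hdet
  have h4 := sq_le_sq' (abs_le.1 h0).1 (abs_le.1 h0).2
  rw [← sub_eq_zero, ← sq_eq_zero_iff]
  exact le_antisymm (by nlinarith) (sq_nonneg _)

lemma SL2R.trace_commutator_rotation {M N : SL2R} {p q : ℝ} (hM : M.1 = !![p, -q; q, p]) :
    (M * N * M⁻¹ * N⁻¹).1.trace
      = 2 + q ^ 2 * ((N.1 0 0 - N.1 1 1) ^ 2 + (N.1 0 1 + N.1 1 0) ^ 2) := by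
  have h1 := N.mul_sub_mul_eq_one
  have h2 := M.mul_sub_mul_eq_one
  rw [hM] at h2
  simp only [Matrix.of_apply, Matrix.cons_val', Matrix.cons_val_zero, Matrix.cons_val_one,
    Matrix.cons_val_fin_one] at h2
  rw [Matrix.SpecialLinearGroup.coe_mul, Matrix.SpecialLinearGroup.coe_mul,
    Matrix.SpecialLinearGroup.coe_mul, Matrix.SpecialLinearGroup.coe_inv,
    Matrix.SpecialLinearGroup.coe_inv, hM, Matrix.adjugate_fin_two, Matrix.adjugate_fin_two]
  conv_lhs => rw [Matrix.eta_fin_two N.1]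
  simp only [Matrix.mul_fin_two, Matrix.trace_fin_two_of, Matrix.of_apply, Matrix.cons_val',
    Matrix.cons_val_zero, Matrix.cons_val_one, Matrix.cons_val_fin_one]
  linear_combination (2 * p ^ 2 + 2 * q ^ 2) * h1 + 2 * h2

lemma IsDiscreteRep.isVirtuallyCyclicRep_of_elliptic {G : Type*} [Group G] {ρ : G →* SL2R}
    (hd : IsDiscreteRep ρ) (hell : ∀ g, |(ρ g).1.trace| ≤ 2) {g : G}
    (hg : (ρ g).1.trace ^ 2 < 4) : IsVirtuallyCyclicRep ρ := by
  obtain ⟨P, hP⟩ := (ρ g).exists_conj_rotation hg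
  apply IsVirtuallyCyclicRep.of_conj (P := P)
  rw [← trace_conjRep P] at hg
  replace hell : ∀ g, |(conjRep P ρ g).1.trace| ≤ 2 := fun g => by
    rw [trace_conjRep]
    exact hell g
  replace hd := hd.conj P
  rw [← conjRep_apply] at hP
  generalize conjRep P ρ = ρ at *
  obtain ⟨h11, h01⟩ := hP
  have hval : (ρ g).1 = !![(ρ g).1 0 0, -(ρ g).1 1 0; (ρ g).1 1 0, (ρ g).1 0 0] := by
    conv_lhs => rw [Matrix.eta_fin_two (ρ g).1, h01, ← h11]
  have hdet := (ρ g).mul_sub_mul_eq_one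
  rw [Matrix.trace_fin_two, ← h11] at hg
  rw [h01, ← h11] at hdet
  have hq : 0 < (ρ g).1 1 0 ^ 2 := by nlinarith
  refine hd.isVirtuallyCyclicRep_of_rotation fun h => ?_
  have htr := SL2R.trace_commutator_rotation (N := ρ h) hval
  rw [← map_inv, ← map_inv, ← map_mul, ← map_mul, ← map_mul] at htr
  have hle := (le_abs_self _).trans (hell (g * h * g⁻¹ * h⁻¹))
  rw [htr] at hle
  have hsum : (ρ h).1 0 0 - (ρ h).1 1 1 = 0 ∧ (ρ h).1 0 1 + (ρ h).1 1 0 = 0 := by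
    have : ((ρ h).1 0 0 - (ρ h).1 1 1) ^ 2 + ((ρ h).1 0 1 + (ρ h).1 1 0) ^ 2 ≤ 0 := by
      by_contra! hpos
      linarith [mul_pos hq hpos]
    constructor <;> rw [← sq_eq_zero_iff] <;>
      nlinarith [sq_nonneg ((ρ h).1 0 0 - (ρ h).1 1 1), sq_nonneg ((ρ h).1 0 1 + (ρ h).1 1 0)]
  exact ⟨sub_eq_zero.1 hsum.1, eq_neg_of_add_eq_zero_left hsum.2⟩

/-- A discrete representation without hyperbolic elements is elementary. -/
lemma IsDiscreteRep.isVirtuallyCyclicRep_of_abs_trace_le {G : Type*} [Group G] {ρ : G →* SL2R}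
    (hd : IsDiscreteRep ρ) (hell : ∀ g, |(ρ g).1.trace| ≤ 2) : IsVirtuallyCyclicRep ρ := by
  by_cases hcentral : ∀ g, ρ g = 1 ∨ ρ g = -1
  · exact ⟨⊤, inferInstance, 1, fun h _ => ⟨0, by simpa using hcentral h⟩⟩
  push Not at hcentral
  obtain ⟨g, hg1, hg2⟩ := hcentral
  have hle : (ρ g).1.trace ^ 2 ≤ 4 := by
    have := sq_le_sq' (abs_le.1 (hell g)).1 (abs_le.1 (hell g)).2
    linarith
  rcases hle.lt_or_eq with h | h
  · exact hd.isVirtuallyCyclicRep_of_elliptic hell h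
  · exact hd.isVirtuallyCyclicRep_of_parabolic hell h hg1 hg2

/-- A discrete representation whose translation lengths lie in a cyclic group is elementary. -/
lemma IsDiscreteRep.isVirtuallyCyclicRep_of_hasLengthsIn {G : Type*} [Group G] {ρ : G →* SL2R}
    (hd : IsDiscreteRep ρ) {α : ℝ} (hα : HasLengthsIn ρ α) : IsVirtuallyCyclicRep ρ := by
  by_cases hell : ∀ g, |(ρ g).1.trace| ≤ 2
  · exact hd.isVirtuallyCyclicRep_of_abs_trace_le hell
  · push Not at hell
    obtain ⟨g, hg⟩ := hell
    exact hd.isVirtuallyCyclicRep_of_hyperbolic hα hg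

lemma SL2R.neg_one_mem_center : (-1 : SL2R) ∈ Subgroup.center SL2R := by
  rw [Subgroup.mem_center_iff]
  intro g
  simp

lemma SL2R.eq_one_or_eq_neg_one_of_mem_center {M : SL2R} (hM : M ∈ Subgroup.center SL2R) :
    M = 1 ∨ M = -1 := by
  rw [Matrix.SpecialLinearGroup.mem_center_iff] at hM
  obtain ⟨r, hr, hM⟩ := hM
  rw [Fintype.card_fin, sq, mul_self_eq_one_iff] at hr
  rcases hr with rfl | rfl
  · left
    ext i j
    simp [← hM]
  · right
    ext i j
    rw [← hM]
    fin_cases i <;> fin_cases j <;> simp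

/-- The preimage in `SL(2, ℝ)` of a discrete subgroup of `PSL(2, ℝ)` is discrete. -/
lemma isDiscreteRep_comap (Γ : Subgroup PSL2R) (hdisc : DiscreteTopology Γ) :
    IsDiscreteRep (Γ.comap (QuotientGroup.mk' (Subgroup.center SL2R))).subtype := by
  have h1 : {(1 : Γ)} ∈ 𝓝 (1 : Γ) := by
    rw [nhds_discrete]
    exact rfl
  rw [nhds_subtype, mem_comap] at h1
  obtain ⟨U, hU, hU1⟩ := h1
  have hcont : Continuous (QuotientGroup.mk : SL2R → PSL2R) := continuous_quot_mk
  have hV : (QuotientGroup.mk : SL2R → PSL2R) ⁻¹' U ∈ 𝓝 (1 : SL2R) :=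
    hcont.continuousAt.preimage_mem_nhds hU
  rw [nhds_induced, mem_comap] at hV
  obtain ⟨V, hV, hVU⟩ := hV
  have hpos : ∀ᶠ M : Matrix (Fin 2) (Fin 2) ℝ in 𝓝 1, 0 < M 0 0 := by
    have hc : Continuous fun M : Matrix (Fin 2) (Fin 2) ℝ => M 0 0 := by fun_prop
    exact hc.continuousAt.eventually (lt_mem_nhds (by simp))
  filter_upwards [hV, hpos] with M hM hM0
  rintro ⟨g, hg⟩ rfl
  have hgΓ : (QuotientGroup.mk g : PSL2R) ∈ Γ := hg
  have hgU : (QuotientGroup.mk g : PSL2R) ∈ U := hVU hM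
  have hone : (⟨QuotientGroup.mk g, hgΓ⟩ : Γ) = 1 := hU1 hgU
  have hcenter : g ∈ Subgroup.center SL2R := by
    rw [← QuotientGroup.eq_one_iff]
    exact congrArg Subtype.val hone
  rcases SL2R.eq_one_or_eq_neg_one_of_mem_center hcenter with h | h
  · exact h
  · exfalso
    simp only [Subgroup.coe_subtype, h, Matrix.SpecialLinearGroup.coe_neg] at hM0
    norm_num at hM0

/-- If the preimage of `Γ` in `SL(2, ℝ)` is cyclic modulo `{±1}` up to finite index, then `Γ` is
virtually cyclic. -/
lemma exists_isCyclic_finiteIndex (Γ : Subgroup PSL2R)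
    (h : IsVirtuallyCyclicRep (Γ.comap (QuotientGroup.mk' (Subgroup.center SL2R))).subtype) :
    ∃ H : Subgroup Γ, IsCyclic H ∧ H.FiniteIndex := by
  obtain ⟨H, hH, h₀, hcyc⟩ := h
  let π := (QuotientGroup.mk' (Subgroup.center SL2R)).subgroupComap Γ
  have hsurj : Function.Surjective π :=
    MonoidHom.subgroupComap_surjective_of_surjective _ _ (QuotientGroup.mk'_surjective _)
  have hle : H.map π ≤ Subgroup.zpowers (π h₀) := by
    rintro _ ⟨g, hg, rfl⟩
    obtain ⟨k, hk⟩ := hcyc g hg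
    refine ⟨k, ?_⟩
    apply Subtype.ext
    change (QuotientGroup.mk (h₀ : SL2R) : PSL2R) ^ k = QuotientGroup.mk (g : SL2R)
    simp only [Subgroup.coe_subtype] at hk
    rw [← QuotientGroup.mk_zpow]
    rcases hk with hk | hk
    · rw [hk]
    · rw [hk, QuotientGroup.eq]
      simpa using SL2R.neg_one_mem_center
  refine ⟨H.map π, ?_, ?_⟩
  · exact isCyclic_of_injective (Subgroup.inclusion hle) (Subgroup.inclusion_injective hle)
  · exact ⟨ne_zero_of_dvd_ne_zero hH.index_ne_zero (Subgroup.index_map_dvd H hsurj)⟩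

end Helpers

/-- Dal'Bo's non-arithmeticity theorem: the length spectrum of a non-elementary Fuchsian
group generates a dense additive subgroup of `ℝ`. -/
theorem length_spectrum_dense (Γ : Subgroup PSL2R)
    (hdisc : DiscreteTopology Γ)
    (hnonelem : ¬ ∃ H : Subgroup Γ, IsCyclic H ∧ H.FiniteIndex) :
    Dense (AddSubgroup.closure (lengthSpectrum Γ) : Set ℝ) := by
  rcases AddSubgroup.dense_or_cyclic (AddSubgroup.closure (lengthSpectrum Γ)) with h | ⟨α, hα⟩
  · exact h
  · refine absurd (exists_isCyclic_finiteIndex Γ ?_) hnonelem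
    refine (isDiscreteRep_comap Γ hdisc).isVirtuallyCyclicRep_of_hasLengthsIn (α := α) ?_
    rintro ⟨g, hg⟩ htr
    have hmem : translationLength (g : Matrix (Fin 2) (Fin 2) ℝ).trace
        ∈ AddSubgroup.closure (lengthSpectrum Γ) :=
      AddSubgroup.subset_closure ⟨QuotientGroup.mk g, hg, g, rfl, htr, rfl⟩
    rw [hα, AddSubgroup.mem_closure_singleton] at hmem
    obtain ⟨k, hk⟩ := hmem
    exact ⟨k, by rw [← zsmul_eq_mul]; exact hk.symm⟩
end

section
/- Let Γ be a finitely generated Fuchsian group (a finitely generated discrete subgroup of PSL₂(ℝ)), let kΓ ⊆ ℝ be its trace field, let r ∈ kΓ with r > 0 and r ≠ 1, and let K be a finitely generated field extension of kΓ contained in ℝ. Then there are only finitely many rational numbers q with 0 < q < 1 such that r^q (the positive real power) has degree at most 2 over K. -/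
/-- The trace field of a subgroup `Γ ≤ PSL(2, ℝ)`: the subfield of `ℝ` generated over `ℚ`
by the traces of all `SL(2, ℝ)`-representatives of elements of `Γ`. -/
noncomputable def traceField (Γ : Subgroup PSL2R) : IntermediateField ℚ ℝ :=
  IntermediateField.adjoin ℚ
    {x : ℝ | ∃ g : SL2R, QuotientGroup.mk g ∈ Γ ∧
      Matrix.trace ((g : Matrix (Fin 2) (Fin 2) ℝ)) = x}

open IntermediateField in
/-- The relative algebraic closure of a field in a finitely generated extension is finite. -/
theorem finite_algebraicClosure_of_essFiniteType (F L : Type*) [Field F] [Field L] [Algebra F L]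
    [Algebra.EssFiniteType F L] : Module.Finite F (algebraicClosure F L) := by
  obtain ⟨s, hs⟩ := exists_finset_isTranscendenceBasis F L
  have halg : Algebra.IsAlgebraic (adjoin F (s : Set L)) L := by
    convert hs.isAlgebraic_field <;> simp
  have : Algebra.EssFiniteType (adjoin F (s : Set L)) L := .of_comp F _ _
  have hfin : Module.Finite (adjoin F (s : Set L)) L :=
    Algebra.finite_of_essFiniteType_of_isAlgebraic
  have hind := hs.1.algebraicClosure
  let A := algebraicClosure F L
  let b := Module.Basis.ofVectorSpace F A
  have hb : LinearIndependent (Algebra.adjoin F (s : Set L)) (fun i => (b i : L)) := by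
    rw [linearIndependent_iff']
    intro t g hg i hi
    have hp (j) : ∃ p : MvPolynomial s F, MvPolynomial.aeval ((↑) : s → L) p = (g j : L) := by
      obtain ⟨p, hp⟩ := (Algebra.adjoin_eq_range F (s : Set L)).le (g j).2
      exact ⟨p, hp⟩
    choose p hp using hp
    have h0 : ∑ j ∈ t, MvPolynomial.C (b j) * MvPolynomial.map (algebraMap F A) (p j) = 0 := by
      apply hind
      simp only [map_sum, map_mul, map_zero, MvPolynomial.aeval_C]
      rw [← hg]
      refine Finset.sum_congr rfl fun j _ => ?_
      rw [MvPolynomial.aeval_map_algebraMap, hp, mul_comm]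
      rfl
    have hpi : p i = 0 := by
      ext m
      have h1 := congrArg (MvPolynomial.coeff m) h0
      simp only [MvPolynomial.coeff_sum, MvPolynomial.coeff_C_mul, MvPolynomial.coeff_map,
        MvPolynomial.coeff_zero] at h1
      refine linearIndependent_iff'.1 b.linearIndependent t (fun j => (p j).coeff m) ?_ i hi
      rw [← h1]
      refine Finset.sum_congr rfl fun j _ => ?_
      rw [Algebra.smul_def, mul_comm]
    have := hp i
    rw [hpi, map_zero] at this
    exact Subtype.ext this.symm
  open scoped algebraAdjoinAdjoin in
  have hb' : LinearIndependent (adjoin F (s : Set L)) (fun i => (b i : L)) :=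
    (LinearIndependent.iff_fractionRing (Algebra.adjoin F (s : Set L)) _).1 hb
  have := hb'.finite
  exact Module.Finite.of_basis b

/-- A transcendental element of a finitely generated extension has `n`-th roots for only finitely
many `n`. -/
theorem finite_setOf_exists_pow_eq_of_transcendental (F : Type*) {L : Type*} [Field F] [Field L]
    [Algebra F L] [Algebra.EssFiniteType F L] {t : L} (ht : Transcendental F t) :
    {n : ℕ | 0 < n ∧ ∃ s : L, s ^ n = t}.Finite := by
  let f : RatFunc F →ₐ[F] L := RatFunc.liftAlgHom (Polynomial.aeval t)
    (nonZeroDivisors_le_comap_nonZeroDivisors_of_injective _ (transcendental_iff_injective.1 ht))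
  have hfX : f RatFunc.X = t := by
    simp [f, RatFunc.liftAlgHom_apply]
  let : Algebra (RatFunc F) L := f.toAlgebra
  have : IsScalarTower F (RatFunc F) L := IsScalarTower.of_algebraMap_eq' f.comp_algebraMap.symm
  have : Algebra.EssFiniteType (RatFunc F) L := .of_comp F _ _
  have := finite_algebraicClosure_of_essFiniteType (RatFunc F) L
  let A := algebraicClosure (RatFunc F) L
  refine (Set.finite_Iic (Module.finrank (RatFunc F) A)).subset ?_
  rintro n ⟨hn, s, hs⟩
  have hsA : s ∈ A := by
    refine mem_algebraicClosure_iff.2 (IsAlgebraic.of_pow hn ?_)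
    rw [hs, ← hfX]
    exact isAlgebraic_algebraMap (A := L) (RatFunc.X : RatFunc F)
  have hpow : (⟨s, hsA⟩ : A) ^ n = algebraMap (RatFunc F) A RatFunc.X :=
    Subtype.ext (hs.trans hfX.symm)
  have hnorm := congrArg (Algebra.norm (RatFunc F)) hpow
  rw [map_pow, Algebra.norm_algebraMap] at hnorm
  have hdeg (x : RatFunc F) (hx : x ≠ 0) (m : ℕ) : (x ^ m).intDegree = m * x.intDegree := by
    induction m with
    | zero => simp
    | succ m ih =>
      rw [pow_succ, RatFunc.intDegree_mul (pow_ne_zero _ hx) hx, ih]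
      push_cast
      ring
  have hN : Algebra.norm (RatFunc F) (⟨s, hsA⟩ : A) ≠ 0 := by
    intro h
    rw [h, zero_pow hn.ne'] at hnorm
    exact pow_ne_zero _ RatFunc.X_ne_zero hnorm.symm
  have := congrArg RatFunc.intDegree hnorm
  rw [hdeg _ hN, hdeg _ RatFunc.X_ne_zero, RatFunc.intDegree_X, mul_one] at this
  exact Nat.le_of_dvd Module.finrank_pos (Int.natCast_dvd_natCast.1 ⟨_, this.symm⟩)

/-- An algebraic number has only finitely many roots of any order in a finitely generated field of
characteristic zero. -/
theorem finite_setOf_pow_eq_of_isAlgebraic {L : Type*} [Field L] [CharZero L]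
    [Algebra.EssFiniteType ℚ L] {t : L} (ht : IsAlgebraic ℚ t) :
    {s : L | ∃ n : ℕ, 0 < n ∧ s ^ n = t}.Finite := by
  have := finite_algebraicClosure_of_essFiniteType ℚ L
  let A := algebraicClosure ℚ L
  have : NumberField A := { }
  let t' : A := ⟨t, mem_algebraicClosure_iff.2 ht⟩
  refine ((Northcott.finite_le (h := Height.mulHeight₁ (K := A)) (Height.mulHeight₁ t')).image
    ((↑) : A → L)).subset ?_
  rintro s ⟨n, hn, hs⟩
  have hsA : s ∈ A := mem_algebraicClosure_iff.2 (IsAlgebraic.of_pow hn (hs ▸ ht))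
  refine ⟨⟨s, hsA⟩, ?_, rfl⟩
  have hpow : (⟨s, hsA⟩ : A) ^ n = t' := Subtype.ext hs
  rw [Set.mem_ofPred_eq, ← hpow, Height.mulHeight₁_pow]
  exact le_self_pow₀ (Height.one_le_mulHeight₁ _) hn.ne'

/-- In a finitely generated subfield of `ℝ`, a positive `t ≠ 1` has positive `n`-th roots for only
finitely many `n`. -/
theorem finite_setOf_rpow_inv_mem {L : IntermediateField ℚ ℝ} (hL : L.FG) {t : ℝ} (htL : t ∈ L)
    (ht0 : 0 < t) (ht1 : t ≠ 1) : {n : ℕ | 0 < n ∧ t ^ (n : ℝ)⁻¹ ∈ L}.Finite := by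
  have : Algebra.EssFiniteType ℚ L := by
    convert IntermediateField.essFiniteType_iff.2 hL
    all_goals rfl
  by_cases ht : IsAlgebraic ℚ (⟨t, htL⟩ : L)
  · refine Set.Finite.of_finite_image (f := fun n : ℕ => t ^ (n : ℝ)⁻¹)
      (((finite_setOf_pow_eq_of_isAlgebraic ht).image ((↑) : L → ℝ)).subset ?_) ?_
    · rintro _ ⟨n, ⟨hn, hmem⟩, rfl⟩
      exact ⟨⟨_, hmem⟩, ⟨n, hn, Subtype.ext (Real.rpow_inv_natCast_pow ht0.le hn.ne')⟩, rfl⟩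
    · intro m _ n _ hmn
      exact Nat.cast_injective (inv_injective ((Real.rpow_right_inj ht0 ht1).1 hmn))
  · refine (finite_setOf_exists_pow_eq_of_transcendental ℚ (t := (⟨t, htL⟩ : L)) ht).subset ?_
    rintro n ⟨hn, hmem⟩
    exact ⟨hn, ⟨_, hmem⟩, Subtype.ext (Real.rpow_inv_natCast_pow ht0.le hn.ne')⟩

open IntermediateField in
/-- If `r ^ q` is at most quadratic over a subfield of `ℝ` containing `r`, then this subfield
contains the root of `r ^ 2` of order the denominator of `q`. -/
theorem sq_rpow_inv_den_mem_of_finrank_adjoin_le_two {K : IntermediateField ℚ ℝ} {r : ℝ}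
    (hrK : r ∈ K) (hr : 0 < r) {q : ℚ} (halg : IsAlgebraic K (r ^ (q : ℝ)))
    (hdeg : Module.finrank K K⟮r ^ (q : ℝ)⟯ ≤ 2) : (r ^ 2) ^ (q.den : ℝ)⁻¹ ∈ K := by
  have hfin : FiniteDimensional K K⟮r ^ (q : ℝ)⟯ := adjoin.finiteDimensional halg.isIntegral
  have : Module.Free K K⟮r ^ (q : ℝ)⟯ := Module.Free.of_divisionRing ..
  have hden : (q.den : ℝ) ≠ 0 := Nat.cast_ne_zero.2 q.den_nz
  have hmem : r ^ (q.den : ℝ)⁻¹ ∈ K⟮r ^ (q : ℝ)⟯ := by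
    obtain ⟨u, v, huv⟩ : IsCoprime q.num (q.den : ℤ) :=
      Int.isCoprime_iff_gcd_eq_one.2 q.reduced
    have hr' : r ∈ K⟮r ^ (q : ℝ)⟯ := K⟮r ^ (q : ℝ)⟯.algebraMap_mem ⟨r, hrK⟩
    have : r ^ (q.den : ℝ)⁻¹ = (r ^ (q : ℝ)) ^ u * r ^ v := by
      rw [← Real.rpow_intCast, ← Real.rpow_intCast, ← Real.rpow_mul hr.le, ← Real.rpow_add hr]
      congr 1
      have huv' : (u : ℝ) * q.num + v * q.den = 1 := by exact_mod_cast huv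
      rw [Rat.cast_def]
      field_simp
      linarith
    rw [this]
    exact mul_mem (zpow_mem (mem_adjoin_simple_self K _) u) (zpow_mem hr' v)
  set d := Module.finrank K K⟮r ^ (q : ℝ)⟯
  have hpow : (⟨_, hmem⟩ : K⟮r ^ (q : ℝ)⟯) ^ q.den = algebraMap K _ ⟨r, hrK⟩ :=
    Subtype.ext (Real.rpow_inv_natCast_pow hr.le q.den_nz)
  have hnorm := congrArg (Algebra.norm K) hpow
  rw [map_pow, Algebra.norm_algebraMap] at hnorm
  set N : K := Algebra.norm K (⟨_, hmem⟩ : K⟮r ^ (q : ℝ)⟯)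
  have hN : (N : ℝ) ^ q.den = r ^ d := congrArg ((↑) : K → ℝ) hnorm
  have habs : |(N : ℝ)| ^ q.den = r ^ d := by
    rw [← abs_pow, hN, abs_of_pos (pow_pos hr d)]
  have hroot : |(N : ℝ)| = (r ^ d) ^ (q.den : ℝ)⁻¹ := by
    rw [← habs, Real.pow_rpow_inv_natCast (abs_nonneg _) q.den_nz]
  have habsK : |(N : ℝ)| ∈ K := by
    rcases abs_choice (N : ℝ) with h | h <;> rw [h]
    exacts [N.2, neg_mem N.2]
  have hd : 0 < d := Module.finrank_pos
  interval_cases d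
  · rw [← Real.rpow_pow_comm hr.le, ← pow_one r, ← hroot]
    exact pow_mem habsK 2
  · rwa [← hroot]

/-- The trace field of a finitely generated subgroup of `PSL(2, ℝ)` is contained in a finitely
generated field. -/
theorem exists_fg_traceField_le (Γ : Subgroup PSL2R) (hfg : Group.FG Γ) :
    ∃ E : IntermediateField ℚ ℝ, E.FG ∧ traceField Γ ≤ E := by
  obtain ⟨S, hS⟩ := (Group.fg_iff_subgroup_fg Γ).1 hfg
  let T : Set ℝ := ⋃ g ∈ S, Set.range fun ij : Fin 2 × Fin 2 =>
    (Quotient.out g : SL2R).1 ij.1 ij.2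
  have hT : T.Finite := S.finite_toSet.biUnion fun g _ => Set.finite_range _
  let E := IntermediateField.adjoin ℚ T
  refine ⟨E, IntermediateField.fg_adjoin_of_finite hT, IntermediateField.adjoin_le_iff.2 ?_⟩
  let H : Subgroup SL2R := (Matrix.SpecialLinearGroup.map (n := Fin 2) (algebraMap E ℝ)).range
  have hΓ : Γ ≤ H.map (QuotientGroup.mk' _) := by
    rw [← hS, Subgroup.closure_le]
    intro g hg
    refine ⟨Quotient.out g, ?_, QuotientGroup.out_eq' g⟩
    have hent (i j) : (Quotient.out g : SL2R).1 i j ∈ E :=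
      IntermediateField.subset_adjoin _ _ (Set.mem_biUnion hg ⟨(i, j), rfl⟩)
    let M : Matrix (Fin 2) (Fin 2) E := fun i j => ⟨_, hent i j⟩
    have hM : (algebraMap E ℝ).mapMatrix M = (Quotient.out g : SL2R).1 := rfl
    refine ⟨⟨M, (algebraMap E ℝ).injective ?_⟩, Subtype.ext hM⟩
    rw [RingHom.map_det, hM, map_one]
    exact (Quotient.out g : SL2R).2
  rintro _ ⟨g, hg, rfl⟩
  obtain ⟨_, ⟨h, rfl⟩, hhg⟩ := hΓ hg
  have hc := QuotientGroup.eq.1 hhg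
  obtain ⟨z, hz, hzc⟩ := Matrix.SpecialLinearGroup.mem_center_iff.1 hc
  set m := Matrix.SpecialLinearGroup.map (n := Fin 2) (algebraMap E ℝ) h
  have hgm : g = m * (m⁻¹ * g) := by group
  have htr : Matrix.trace (g : Matrix (Fin 2) (Fin 2) ℝ) =
      algebraMap E ℝ (Matrix.trace h.1) * z := by
    rw [hgm, Matrix.SpecialLinearGroup.coe_mul, ← hzc]
    simp [Matrix.trace_fin_two, m, Matrix.mul_apply, add_mul]
  rw [htr]
  refine mul_mem (Subtype.mem _) ?_
  have hz' : z * z = 1 := by simpa [sq] using hz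
  rcases mul_self_eq_one_iff.1 hz' with h | h
  all_goals rw [h]
  exacts [one_mem E, neg_mem (one_mem E)]

/-- Let `Γ` be a finitely generated Fuchsian group with trace field `kΓ`, let
`r ∈ kΓ` be positive with `r ≠ 1`, and let `K ⊆ ℝ` be a finitely generated field
extension of `kΓ`.  Then there are only finitely many rationals `0 < q < 1` such that
`r ^ q` is at most quadratic over `K`. -/
theorem finitely_many_quadratic_rational_powers (Γ : Subgroup PSL2R)
    (hdisc : DiscreteTopology Γ) (hfg : Group.FG Γ)
    (K : IntermediateField ℚ ℝ) (hle : traceField Γ ≤ K)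
    (hKfg : (IntermediateField.extendScalars hle).FG)
    (r : ℝ) (hrmem : r ∈ traceField Γ) (hr0 : 0 < r) (hr1 : r ≠ 1) :
    {q : ℚ | 0 < q ∧ q < 1 ∧ IsAlgebraic K (r ^ (q : ℝ)) ∧
      Module.finrank K (IntermediateField.adjoin K {r ^ (q : ℝ)}) ≤ 2}.Finite := by
  obtain ⟨E, hE, hΓE⟩ := exists_fg_traceField_le Γ hfg
  obtain ⟨S, hS⟩ := hKfg
  let L := E ⊔ IntermediateField.adjoin ℚ (S : Set ℝ)
  have hL : L.FG := IntermediateField.fg_sup hE (IntermediateField.fg_adjoin_finset S)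
  have hΓL : traceField Γ ≤ L := hΓE.trans le_sup_left
  have hKL : K ≤ L := by
    have : IntermediateField.extendScalars hle ≤ IntermediateField.extendScalars hΓL := by
      rw [← hS, IntermediateField.adjoin_le_iff]
      intro x hx
      exact (le_sup_right : _ ≤ L) (IntermediateField.subset_adjoin ℚ _ hx)
    exact this
  have hr2 : r ^ 2 ≠ 1 := fun h => hr1 ((pow_eq_one_iff_of_nonneg hr0.le two_ne_zero).1 h)
  have hfin := finite_setOf_rpow_inv_mem hL (pow_mem (hΓL hrmem) 2) (pow_pos hr0 2) hr2
  refine (hfin.biUnion (t := fun n : ℕ => (fun a : ℤ => (a : ℚ) / n) '' Set.Ico (0 : ℤ) n)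
    fun n _ => (Set.finite_Ico _ _).image _).subset ?_
  rintro q ⟨hq0, hq1, halg, hdeg⟩
  refine Set.mem_biUnion (x := q.den) ⟨q.den_pos, hKL
    (sq_rpow_inv_den_mem_of_finrank_adjoin_le_two (hle hrmem) hr0 halg hdeg)⟩
    ⟨q.num, ⟨(Rat.num_pos.2 hq0).le, Rat.num_lt_denom_iff.2 hq1⟩, Rat.num_div_den q⟩
end

section
/- Let K ⊆ ℝ be a field, let n, t be positive natural numbers, and let α ∈ ℝ be nonzero such that α^n ∈ K and α is algebraic over K of degree [K(α):K] = t. Then α^t ∈ K. -/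
/-- Let `K ⊆ ℝ` be a field, `n, t` positive naturals, and `α ∈ ℝ` nonzero with
`α ^ n ∈ K` and `[K(α) : K] = t`.  Then `α ^ t ∈ K`. -/
theorem pow_degree_mem (K : IntermediateField ℚ ℝ) (n t : ℕ) (hn : 0 < n) (ht : 0 < t)
    (α : ℝ) (hα : α ≠ 0) (hαn : α ^ n ∈ K) (halg : IsAlgebraic K α)
    (hdeg : Module.finrank K (IntermediateField.adjoin K {α}) = t) :
    α ^ t ∈ K := by
  let N : K := Algebra.norm K (IntermediateField.AdjoinSimple.gen K α)
  -- Taking norms from `K(α)` to `K` in `α ^ n = a` shows `N ^ n = a ^ t`.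
  have hgen : IntermediateField.AdjoinSimple.gen K α ^ n =
      algebraMap K (IntermediateField.adjoin K {α}) ⟨α ^ n, hαn⟩ :=
    Subtype.ext rfl
  have hN : N ^ n = (⟨α ^ n, hαn⟩ : K) ^ t := by
    rw [← map_pow, hgen, Algebra.norm_algebraMap, hdeg]
  have hNα : (N : ℝ) ^ n = (α ^ t) ^ n := by
    rw [pow_right_comm]
    exact congrArg Subtype.val hN
  have habs : |(N : ℝ)| = |α ^ t| :=
    (pow_left_inj₀ (abs_nonneg _) (abs_nonneg _) hn.ne').mp (by rw [← abs_pow, hNα, abs_pow])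
  rcases abs_eq_abs.mp habs with h | h
  · exact h ▸ N.2
  · rw [← neg_neg (α ^ t), ← h]
    exact neg_mem N.2
end

section
/- Let K ⊆ ℝ be a field that is a finitely generated extension of ℚ, let r ∈ K with r > 0 and r ≠ 1, and let t be a positive natural number. Then there are only finitely many natural numbers n ≥ 1 such that the positive real n-th root r^(1/n) satisfies [K(r^(1/n)):K] = t. -/
open IntermediateField

/-- An element of a number field has only finitely many roots, of all orders together, in that
field. -/
theorem finite_setOf_pow_eq_of_numberField (L : Type*) [Field L] [NumberField L] (u : L) :
    {v : L | ∃ n : ℕ, 1 ≤ n ∧ v ^ n = u}.Finite := by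
  have hu : IsAlgebraic ℤ u :=
    (IsFractionRing.isAlgebraic_iff ℤ ℚ L).mpr (Algebra.IsAlgebraic.isAlgebraic u)
  obtain ⟨N, hN0, hN⟩ := hu.exists_integral_multiple
  have hN0' : (N : L) ≠ 0 := by exact_mod_cast hN0
  let C : ℝ := 1 + ∑ φ : L →+* ℂ, ‖φ u‖
  have hC1 : 1 ≤ C := by
    have : 0 ≤ ∑ φ : L →+* ℂ, ‖φ u‖ := by positivity
    linarith
  have hC (φ : L →+* ℂ) : ‖φ u‖ ≤ C := by
    have := Finset.single_le_sum (f := fun φ : L →+* ℂ ↦ ‖φ u‖) (fun _ _ ↦ norm_nonneg _)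
      (Finset.mem_univ φ)
    simp only [C]
    linarith
  refine ((NumberField.Embeddings.finite_of_norm_le L ℂ (|N| * C)).preimage
    (mul_right_injective₀ hN0').injOn).subset ?_
  rintro v ⟨n, hn, hv⟩
  refine ⟨IsIntegral.of_pow (n := n) (by omega) ?_, fun φ ↦ ?_⟩
  · obtain ⟨m, rfl⟩ := Nat.exists_eq_add_of_le' hn
    have : ((N : L) * v) ^ (m + 1) = (N : L) ^ m * (N • u) := by
      rw [mul_pow, hv, zsmul_eq_mul, pow_succ, mul_assoc]
    rw [this]
    exact ((isIntegral_algebraMap (R := ℤ) (A := L) (x := N)).pow m).mul hN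
  · rw [map_mul, norm_mul, map_intCast, Complex.norm_intCast]
    push_cast
    gcongr
    by_contra! h
    have h1 : ‖φ v‖ ≤ ‖φ v‖ ^ n := le_self_pow₀ (hC1.trans h.le) (by omega)
    rw [← norm_pow, ← map_pow, hv] at h1
    linarith [hC φ]

/-- Elements algebraic over the base of a finitely generated field extension form a finite
extension. -/
theorem finiteDimensional_algebraicClosure_of_essFiniteType (k K : Type*) [Field k] [Field K]
    [Algebra k K] [Algebra.EssFiniteType k K] :
    FiniteDimensional k (algebraicClosure k K) := by
  obtain ⟨s, hs⟩ := exists_isTranscendenceBasis k K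
  let R := Algebra.adjoin k (Set.range ((↑) : s → K))
  let F := adjoin k (Set.range ((↑) : s → K))
  have : Algebra.IsAlgebraic F K := hs.isAlgebraic_field
  have : Algebra.EssFiniteType F K := .of_comp k F K
  have : FiniteDimensional F K := Algebra.finite_of_essFiniteType_of_isAlgebraic
  let A := algebraicClosure k K
  let b := (MvPolynomial.basisMonomials s k).map hs.1.aevalEquiv.toLinearEquiv
  have hdisj : A.toSubalgebra.LinearDisjoint R := by
    refine .of_basis_right _ _ b ?_
    have h1 := (MvPolynomial.basisMonomials s A).linearIndependent.map'
      (MvPolynomial.aeval ((↑) : s → K) : MvPolynomial s A →ₐ[A] K).toLinearMap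
      (LinearMap.ker_eq_bot.mpr hs.1.algebraicClosure)
    have h2 : R.val ∘ b = (MvPolynomial.aeval ((↑) : s → K) :
        MvPolynomial s A →ₐ[A] K).toLinearMap ∘ MvPolynomial.basisMonomials s A := by
      ext m
      simp [b, R, MvPolynomial.aeval_monomial]
    rw [h2]
    exact h1
  let a := Module.Basis.ofVectorSpace k A
  have h2 := hdisj.linearIndependent_left_of_flat a.linearIndependent
  open scoped algebraAdjoinAdjoin in
  have h3 := (LinearIndependent.iff_fractionRing R F).mp h2
  have := h3.finite
  exact Module.Finite.of_basis a

theorem RatFunc.intDegree_pow {k : Type*} [Field k] (x : RatFunc k) (n : ℕ) :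
    (x ^ n).intDegree = n * x.intDegree := by
  by_cases hx : x = 0
  · rcases n with _ | n <;> simp [hx]
  · induction n with
    | zero => simp
    | succ n ih =>
      rw [pow_succ, RatFunc.intDegree_mul (pow_ne_zero n hx) hx, ih]
      push_cast
      ring

/-- For a finitely generated field extension `K / k` there is `d > 0` such that whenever `u : k` is
an `n`-th power in `K`, the element `u ^ d` is an `n`-th power in `k`. -/
theorem exists_pow_isPow_of_essFiniteType (k K : Type*) [Field k] [Field K] [Algebra k K]
    [Algebra.EssFiniteType k K] :
    ∃ d : ℕ, 0 < d ∧ ∀ (u : k) (n : ℕ), 1 ≤ n → ∀ v : K, v ^ n = algebraMap k K u →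
      ∃ w : k, w ^ n = u ^ d := by
  have := finiteDimensional_algebraicClosure_of_essFiniteType k K
  refine ⟨Module.finrank k (algebraicClosure k K), Module.finrank_pos, fun u n hn v hv ↦ ?_⟩
  have hv' : IsAlgebraic k (v ^ n) := hv ▸ isAlgebraic_algebraMap u
  refine ⟨Algebra.norm k (⟨v, mem_algebraicClosure_iff.mpr (.of_pow hn hv')⟩ :
    algebraicClosure k K), ?_⟩
  rw [← map_pow, ← Algebra.norm_algebraMap]
  congr 1
  exact Subtype.ext hv

/-- A transcendental element of a finitely generated field extension is an `n`-th power for only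
finitely many `n`. -/
theorem finite_setOf_exists_pow_eq_of_transcendental_s6 {k K : Type*} [Field k] [Field K] [Algebra k K]
    [Algebra.EssFiniteType k K] {u : K} (hu : Transcendental k u) :
    {n : ℕ | 1 ≤ n ∧ ∃ v : K, v ^ n = u}.Finite := by
  have : Algebra.EssFiniteType k⟮u⟯ K := .of_comp k k⟮u⟯ K
  obtain ⟨d, hd, hroot⟩ := exists_pow_isPow_of_essFiniteType k⟮u⟯ K
  refine (Nat.divisors d).finite_toSet.subset ?_
  rintro n ⟨hn, v, hv⟩
  obtain ⟨w, hw⟩ := hroot (AdjoinSimple.gen k u) n hn v hv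
  let e := RatFunc.algEquivOfTranscendental u hu
  have hdeg := congrArg (fun x ↦ (e.symm x).intDegree) hw
  rw [map_pow, map_pow, RatFunc.algEquivOfTranscendental_symm_gen, RatFunc.intDegree_pow,
    RatFunc.intDegree_pow, RatFunc.intDegree_X, mul_one] at hdeg
  simp only [Finset.mem_coe, Nat.mem_divisors]
  exact ⟨Int.natCast_dvd_natCast.mp ⟨_, hdeg.symm⟩, hd.ne'⟩

/-- In a finitely generated field of characteristic zero, a nonzero element that is not a root of
unity is an `n`-th power for only finitely many `n`. -/
theorem finite_setOf_exists_pow_eq (K : Type*) [Field K] [CharZero K]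
    [Algebra.EssFiniteType ℚ K] (u : K) (hu0 : u ≠ 0) (hu : ∀ k : ℕ, 0 < k → u ^ k ≠ 1) :
    {n : ℕ | 1 ≤ n ∧ ∃ v : K, v ^ n = u}.Finite := by
  by_cases halg : IsAlgebraic ℚ u
  · have := finiteDimensional_algebraicClosure_of_essFiniteType ℚ K
    have : NumberField (algebraicClosure ℚ K) := { }
    have hfin := finite_setOf_pow_eq_of_numberField (algebraicClosure ℚ K)
      ⟨u, mem_algebraicClosure_iff.mpr halg⟩
    have hfin := hfin.image Subtype.val
    have hex (n : ℕ) : ∃ v : K, 1 ≤ n → (∃ v : K, v ^ n = u) → v ^ n = u := by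
      by_cases h : ∃ v : K, v ^ n = u
      · exact ⟨h.choose, fun _ _ ↦ h.choose_spec⟩
      · exact ⟨0, fun _ h' ↦ absurd h' h⟩
    choose v hv using hex
    refine Set.Finite.of_finite_image (f := v) (hfin.subset ?_) ?_
    · rintro _ ⟨n, ⟨hn, h⟩, rfl⟩
      have hvn := hv n hn h
      refine ⟨⟨v n, mem_algebraicClosure_iff.mpr ?_⟩, ⟨n, hn, Subtype.ext hvn⟩, rfl⟩
      exact IsAlgebraic.of_pow hn (hvn ▸ halg)
    · have key (n m : ℕ) (hn : v n ^ n = u) (hm : v n ^ m = u) : ¬ n < m := by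
        intro hlt
        obtain ⟨d, rfl⟩ := Nat.exists_eq_add_of_lt hlt
        rw [add_assoc, pow_add, hn] at hm
        have h1 : v n ^ (d + 1) = 1 := mul_left_cancel₀ hu0 (by rw [hm, mul_one])
        apply hu (d + 1) (by omega)
        rw [← hn, ← pow_mul, mul_comm, pow_mul, h1, one_pow]
      rintro n ⟨hn, hn'⟩ m ⟨hm, hm'⟩ heq
      have h1 := hv n hn hn'
      have h2 := hv m hm hm'
      have := key n m h1 (heq ▸ h2)
      have := key m n h2 (heq ▸ h1)
      omega
  · exact finite_setOf_exists_pow_eq_of_transcendental_s6 halg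


/-- If `K ⊆ ℝ` is a finitely generated field extension of `ℚ`, `r ∈ K` is positive with
`r ≠ 1`, and `t ≥ 1`, then there are only finitely many `n ≥ 1` such that the positive
real root `r ^ (1/n)` has degree exactly `t` over `K`. -/
theorem finitely_many_roots_of_degree (K : IntermediateField ℚ ℝ) (hK : K.FG)
    (r : ℝ) (hrK : r ∈ K) (hr0 : 0 < r) (hr1 : r ≠ 1) (t : ℕ) (ht : 0 < t) :
    {n : ℕ | 1 ≤ n ∧
      Module.finrank K (IntermediateField.adjoin K {r ^ ((n : ℝ)⁻¹)}) = t}.Finite := by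
  have : Algebra.EssFiniteType ℚ K := essFiniteType_iff.mpr hK
  refine (finite_setOf_exists_pow_eq K (⟨r, hrK⟩ ^ t) ?_ ?_).subset ?_
  · exact pow_ne_zero _ fun h ↦ hr0.ne' congr($h.1)
  · intro k hk h
    rw [← pow_mul] at h
    have h' : r ^ (t * k) = 1 := congr($h.1)
    exact hr1 ((pow_eq_one_iff_of_nonneg hr0.le (by positivity)).mp h')
  · rintro n ⟨hn, hdeg⟩
    refine ⟨hn, Algebra.norm K (AdjoinSimple.gen K (r ^ ((n : ℝ)⁻¹))), ?_⟩
    rw [← map_pow, ← hdeg, ← Algebra.norm_algebraMap]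
    congr 1
    apply Subtype.ext
    simpa using Real.rpow_inv_natCast_pow hr0.le (by omega)
end
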